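/- arXiv:1911.05977 — 2 statements merged into one kernel-verified Lean document; each statement's English description precedes it below -/
import Mathlib

section
/- Let τ be a non-discrete Hausdorff locally compact shift-continuous topology on C_Z^0 and let V be a compact open neighbourhood of the zero 0 in (C_Z^0, τ). Then for every nonzero element (a,b) of C_Z^0 the set ↑≼(a,b) ∩ V is finite. -/
/-- The underlying set of the extended bicyclic semigroup: `ℤ × ℤ`. -/
abbrev CZ : Type := ℤ × ℤ

/-- Multiplication of the extended bicyclic semigroup `C_Z`. -/
def CZmul (p q : CZ) : CZ :=
  if p.2 < q.1 then (p.1 - p.2 + q.1, q.2)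
  else if p.2 = q.1 then (p.1, q.2)
  else (p.1, q.2 + p.2 - q.1)

/-- `C_Z` with an adjoined zero; `none` is the zero element. -/
abbrev CZ0 : Type := Option CZ

/-- Multiplication of `C_Z^0`; `none` is a zero element. -/
def CZ0mul : CZ0 → CZ0 → CZ0
  | some p, some q => some (CZmul p q)
  | _, _ => none

/-- Natural partial order on `C_Z`: `(a,b) ≼ (x,y)` iff `a - b = x - y` and `x ≤ a`. -/
def CZle (p q : CZ) : Prop := p.1 - p.2 = q.1 - q.2 ∧ q.1 ≤ p.1

/-- The upper set `↑≼(a,b)` in `C_Z`. -/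
def upSet (p : CZ) : Set CZ := {q | CZle p q}

/-- Natural partial order on `C_Z^0`: zero is below everything. -/
def CZ0le : CZ0 → CZ0 → Prop
  | none, _ => True
  | some _, none => False
  | some p, some q => CZle p q

/-- A topology on `C_Z^0` is shift-continuous if all left and right shifts are continuous. -/
def ShiftCont (t : TopologicalSpace CZ0) : Prop :=
  ∀ s : CZ0, @Continuous _ _ t t (fun u => CZ0mul s u) ∧ @Continuous _ _ t t (fun u => CZ0mul u s)

/-- The upper set of `(c,d)` is a fibre of a two-sided shift. -/
theorem CZ0mul_preimage_eq_upSet (a b c d : ℤ) :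
    (fun u => CZ0mul (CZ0mul (some (a, c)) u) (some (d, b))) ⁻¹' {some (a, b)} =
      some '' upSet (c, d) := by
  ext u
  rcases u with _ | ⟨x, y⟩
  · simp [CZ0mul]
  · simp only [Set.mem_preimage, CZ0mul, CZmul, Set.mem_singleton_iff, Option.some.injEq,
      Set.mem_image, exists_eq_right, upSet, CZle, Set.mem_ofPred_eq]
    grind

theorem ShiftCont.continuous_two_sided {t : TopologicalSpace CZ0} (hsh : ShiftCont t)
    (r s : CZ0) : Continuous (fun u => CZ0mul (CZ0mul r u) s) :=
  (hsh s).2.comp (hsh r).1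

theorem ShiftCont.isClosed_upSet {t : TopologicalSpace CZ0} [T2Space CZ0] (hsh : ShiftCont t)
    (p : CZ) : IsClosed (some '' upSet p : Set CZ0) := by
  obtain ⟨c, d⟩ := p
  rw [← CZ0mul_preimage_eq_upSet 0 0 c d]
  exact isClosed_singleton.preimage (hsh.continuous_two_sided _ _)

/-- By the Baire category theorem a countable locally compact Hausdorff space has isolated points
in every nonempty open set. -/
theorem exists_isOpen_singleton_of_countable {X : Type*} [TopologicalSpace X] [T2Space X]
    [LocallyCompactSpace X] [Countable X] {U : Set X} (hU : IsOpen U) (hne : U.Nonempty) :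
    ∃ x ∈ U, IsOpen ({x} : Set X) := by
  have hd : Dense (⋃ x : X, interior ({x} : Set X)) :=
    dense_iUnion_interior_of_closed (fun _ => isClosed_singleton) (Set.iUnion_of_singleton X)
  obtain ⟨x, hxU, hx⟩ := hd.inter_open_nonempty U hU hne
  obtain ⟨y, hy⟩ := Set.mem_iUnion.1 hx
  obtain rfl : x = y := Set.mem_singleton_iff.1 (interior_subset hy)
  exact ⟨x, hxU, isOpen_singleton_iff_nhds_eq_pure x |>.2
    (le_antisymm (Filter.le_pure_iff.2 (mem_interior_iff_mem_nhds.1 hy)) (pure_le_nhds x))⟩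

theorem ShiftCont.isOpen_singleton_some {t : TopologicalSpace CZ0} [T2Space CZ0]
    [LocallyCompactSpace CZ0] (hsh : ShiftCont t) (p : CZ) : IsOpen ({some p} : Set CZ0) := by
  obtain ⟨x, hx, hxo⟩ := exists_isOpen_singleton_of_countable
    (isOpen_compl_singleton (x := (none : CZ0))) ⟨some (0, 0), by simp⟩
  rcases x with _ | ⟨a, b⟩
  · simp at hx
  obtain ⟨c, d⟩ := p
  have hup : IsOpen (some '' upSet (c, d) : Set CZ0) := by
    rw [← CZ0mul_preimage_eq_upSet a b c d]
    exact hxo.preimage (hsh.continuous_two_sided _ _)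
  have hdiff : ({some (c, d)} : Set CZ0) =
      some '' upSet (c, d) \ some '' upSet (c - 1, d - 1) := by
    ext u
    rcases u with _ | ⟨x, y⟩
    · simp
    · simp only [Set.mem_singleton_iff, Option.some.injEq, Prod.mk.injEq, Set.mem_sdiff,
        Set.mem_image, exists_eq_right, upSet, CZle, Set.mem_ofPred_eq]
      omega
  rw [hdiff]
  exact hup.sdiff (hsh.isClosed_upSet _)

theorem stmt8 (t : TopologicalSpace CZ0) (h2 : @T2Space CZ0 t) (hnd : t ≠ ⊥)
    (hlc : @LocallyCompactSpace CZ0 t) (hsh : ShiftCont t)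
    (V : Set CZ0) (h0V : none ∈ V) (hVc : @IsCompact CZ0 t V) (hVo : @IsOpen CZ0 t V)
    (ab : CZ) :
    (Option.some '' upSet ab ∩ V).Finite := by
  refine (hVc.inter_left (hsh.isClosed_upSet ab)).finite ?_
  refine isDiscrete_iff_forall_mem_exists_isOpen.2 ?_
  rintro _ ⟨⟨p, hp, rfl⟩, hpV⟩
  exact ⟨{some p}, hsh.isOpen_singleton_some p,
    Set.inter_eq_left.2 (Set.singleton_subset_iff.2 ⟨⟨p, hp, rfl⟩, hpV⟩)⟩
end

section
/- Every Hausdorff locally compact semigroup topology on C_Z^0 is discrete; that is, if τ is a Hausdorff locally compact topology on C_Z^0 for which the multiplication map C_Z^0 × C_Z^0 → C_Z^0 is jointly continuous, then τ is the discrete topology. -/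
open Set Filter Topology

/-- Inversion `(a, b) ↦ (b, a)` is an anti-automorphism of `C_Z`. -/
theorem CZmul_swap (p q : CZ) : CZmul p.swap q.swap = (CZmul q p).swap := by
  obtain ⟨a, b⟩ := p
  obtain ⟨c, d⟩ := q
  simp only [CZmul, Prod.swap_prod_mk]
  split_ifs <;> refine Prod.ext ?_ ?_ <;> dsimp only [Prod.fst_swap, Prod.snd_swap] <;> omega

theorem CZmul_of_le {a b c d : ℤ} (h : b ≤ c) : CZmul (a, b) (c, d) = (a - b + c, d) := by
  simp only [CZmul]
  split_ifs <;> refine Prod.ext ?_ ?_ <;> dsimp only <;> omega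

theorem CZmul_of_ge {a b c d : ℤ} (h : c ≤ b) : CZmul (a, b) (c, d) = (a, d + b - c) := by
  simp only [CZmul]
  split_ifs <;> refine Prod.ext ?_ ?_ <;> dsimp only <;> omega

/-- A two-sided translate taking the value `(c, d)` only at `(a, b)`. -/
theorem CZmul_CZmul_eq_iff (a b c d : ℤ) (p : CZ) :
    CZmul (CZmul (c - 1, a - 1) p) (b - 1, d - 1) = (c, d) ↔ p = (a, b) := by
  obtain ⟨x, y⟩ := p
  simp only [CZmul]
  split_ifs <;> simp only [Prod.mk.injEq] <;> omega

/-- The combinatorial properties of the set of nonzero elements of a compact neighbourhood of a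
non-isolated zero in `C_Z^0`, all of whose nonzero elements are isolated. -/
structure IsZeroTrace (A : Set CZ) : Prop where
  infinite : A.Infinite
  left : ∀ p, {a ∈ A | CZmul p a ∉ A}.Finite
  right : ∀ p, {a ∈ A | CZmul a p ∉ A}.Finite
  left_fiber : ∀ p q, {a ∈ A | CZmul p a = q}.Finite
  right_fiber : ∀ p q, {a ∈ A | CZmul a p = q}.Finite
  mul : ∀ p, ∃ E : Set CZ, E.Finite ∧ ∀ a ∈ A, ∀ b ∈ A, a ∉ E → b ∉ E → CZmul a b ≠ p

theorem Set.Finite.exists_abs_lt {S : Set (ℤ × ℤ)} (hS : S.Finite) :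
    ∃ N : ℤ, ∀ p ∈ S, |p.1| < N ∧ |p.2| < N := by
  obtain ⟨M, hM⟩ := (hS.image fun p => max |p.1| |p.2|).bddAbove
  refine ⟨M + 1, fun p hp => ?_⟩
  have := max_le_iff.1 (hM (mem_image_of_mem _ hp))
  omega

namespace IsZeroTrace

variable {A : Set CZ}

theorem swap (hA : IsZeroTrace A) : IsZeroTrace (Prod.swap ⁻¹' A) := by
  have key : ∀ {P Q : CZ → Prop}, {a | P a}.Finite → (∀ a, Q a → P a.swap) → {a | Q a}.Finite :=
    fun hP h => (hP.preimage Prod.swap_injective.injOn).subset h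
  refine ⟨hA.infinite.preimage (by simp [Prod.swap_surjective.range_eq]), fun p => ?_, fun p => ?_, fun p q => ?_, fun p q => ?_,
    fun p => ?_⟩
  · refine key (hA.right p.swap) fun a ha => ⟨ha.1, ?_⟩
    rw [CZmul_swap]; exact ha.2
  · refine key (hA.left p.swap) fun a ha => ⟨ha.1, ?_⟩
    rw [CZmul_swap]; exact ha.2
  · refine key (hA.right_fiber p.swap q.swap) fun a ha => ⟨ha.1, ?_⟩
    rw [CZmul_swap, ha.2]
  · refine key (hA.left_fiber p.swap q.swap) fun a ha => ⟨ha.1, ?_⟩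
    rw [CZmul_swap, ha.2]
  · obtain ⟨E, hE, h⟩ := hA.mul p.swap
    refine ⟨Prod.swap ⁻¹' E, hE.preimage Prod.swap_injective.injOn, fun a ha b hb ha' hb' hab => ?_⟩
    refine h _ hb _ ha hb' ha' ?_
    rw [CZmul_swap, hab]

/-- Beyond the exceptions to left translation by `(1, 0)`, a row is closed under moving right. -/
theorem forall_ge_mem {x y : ℤ} (hx : 0 ≤ x) (hxy : (x, y) ∈ A)
    (h : ∀ z ≥ x, (z, y) ∈ A → CZmul (1, 0) (z, y) ∈ A) : ∀ z ≥ x, (z, y) ∈ A := by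
  intro z hz
  induction z, hz using Int.leInduction with
  | base => exact hxy
  | succ z hz ih =>
    have := h z hz ih
    rwa [CZmul_of_le (by omega), show (1 : ℤ) - 0 + z = z + 1 by ring] at this

theorem eventually_mem_row (hA : IsZeroTrace A) {y : ℤ} (h : ∀ N, ∃ x ≥ N, (x, y) ∈ A) (y' : ℤ) :
    ∃ N, ∀ x ≥ N, (x, y') ∈ A := by
  obtain ⟨N, hN⟩ := (hA.left (1, 0)).exists_abs_lt
  obtain ⟨x, hx, hxy⟩ := h (max N 0)
  have hrow : ∀ z ≥ x, (z, y) ∈ A := by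
    refine forall_ge_mem (by omega) hxy fun z hz hzy => ?_
    by_contra hc
    have := (abs_lt.1 (hN _ ⟨hzy, hc⟩).1).2
    dsimp only at this
    omega
  obtain ⟨M, hM⟩ := (hA.right (y, y')).exists_abs_lt
  refine ⟨max x M, fun z hz => ?_⟩
  by_contra hc
  have := (abs_lt.1 (hM (z, y) ⟨hrow z (by omega), ?_⟩).1).2
  · dsimp only at this
    omega
  · rwa [CZmul_of_le le_rfl, sub_add_cancel]

theorem eventually_mem_column (hA : IsZeroTrace A) {x : ℤ} (h : ∀ N, ∃ y ≥ N, (x, y) ∈ A)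
    (x' : ℤ) : ∃ N, ∀ y ≥ N, (x', y) ∈ A :=
  hA.swap.eventually_mem_row h x'

theorem column_bddAbove (hA : IsZeroTrace A) (x : ℤ) : ∃ N, ∀ y ≥ N, (x, y) ∉ A := by
  by_contra! h
  have hcol := hA.eventually_mem_column h
  obtain ⟨M, hM⟩ := hcol 0
  obtain ⟨N, hN⟩ := (hA.left (1, 0)).exists_abs_lt
  have hrow : ∀ z ≥ 0, (z, max M N) ∈ A := by
    refine forall_ge_mem le_rfl (hM _ (by omega)) fun z hz hzy => ?_
    by_contra hc
    have := (abs_lt.1 (hN _ ⟨hzy, hc⟩).2).2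
    dsimp only at this
    omega
  obtain ⟨K, hK⟩ := hA.eventually_mem_row (y := max M N)
    (fun n => ⟨max n 0, by omega, hrow _ (by omega)⟩) 0
  obtain ⟨E, hE, hmul⟩ := hA.mul (0, 0)
  obtain ⟨L, hL⟩ := hE.exists_abs_lt
  set n := max (max M K) L
  refine hmul (0, n) (hM n (by omega)) (n, 0) (hK n (by omega)) (fun hn => ?_) (fun hn => ?_) ?_
  · have := (abs_lt.1 (hL _ hn).2).2
    dsimp only at this
    omega
  · have := (abs_lt.1 (hL _ hn).1).2
    dsimp only at this
    omega
  · rw [CZmul_of_ge le_rfl, zero_add, sub_self]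

theorem row_bddAbove (hA : IsZeroTrace A) (y : ℤ) : ∃ N, ∀ x ≥ N, (x, y) ∉ A :=
  hA.swap.column_bddAbove y

theorem column_bddBelow (hA : IsZeroTrace A) (x : ℤ) : ∃ N, ∀ y ≤ N, (x, y) ∉ A := by
  by_contra! h
  obtain ⟨K, hK⟩ := hA.row_bddAbove 0
  obtain ⟨N, hN⟩ := (hA.right (0, 0)).exists_abs_lt
  obtain ⟨y, hy, hxy⟩ := h (min (min 0 (-N)) (x - K))
  by_cases hc : CZmul (x, y) (0, 0) ∈ A
  · rw [CZmul_of_le (by omega)] at hc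
    exact hK _ (by omega) hc
  · have := (abs_lt.1 (hN _ ⟨hxy, hc⟩).2).1
    dsimp only at this
    omega

theorem finite_column (hA : IsZeroTrace A) (x : ℤ) : {a ∈ A | a.1 = x}.Finite := by
  obtain ⟨M, hM⟩ := hA.column_bddBelow x
  obtain ⟨N, hN⟩ := hA.column_bddAbove x
  refine ((finite_singleton x).prod (finite_Icc M N)).subset ?_
  rintro ⟨_, y⟩ ⟨hy, rfl⟩
  refine ⟨rfl, ?_, ?_⟩
  · by_contra hc
    exact hM y (by simp only at hc; omega) hy
  · by_contra hc
    exact hN y (by simp only at hc; omega) hy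

theorem finite_row (hA : IsZeroTrace A) (y : ℤ) : {a ∈ A | a.2 = y}.Finite :=
  ((hA.swap.finite_column y).preimage Prod.swap_injective.injOn).subset fun _ h => h

theorem finite_fst_nonpos (hA : IsZeroTrace A) : {a ∈ A | a.1 ≤ 0}.Finite := by
  refine ((hA.left (0, 0)).union
    ((hA.finite_column 0).biUnion fun b _ => hA.left_fiber (0, 0) b)).subset ?_
  rintro ⟨x, y⟩ ⟨ha, hx⟩
  by_cases hc : CZmul (0, 0) (x, y) ∈ A
  · refine Or.inr (mem_biUnion ⟨hc, ?_⟩ ⟨ha, rfl⟩)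
    rw [CZmul_of_ge hx]
  · exact Or.inl ⟨ha, hc⟩

end IsZeroTrace

theorem not_isZeroTrace (A : Set CZ) : ¬ IsZeroTrace A := by
  intro hA
  refine hA.infinite ((hA.finite_fst_nonpos.union
    ((hA.left (1, 0)).biUnion fun e _ => hA.finite_row e.2)).subset ?_)
  rintro ⟨x, y⟩ hxy
  by_contra hc
  simp only [mem_union, not_or, mem_iUnion, not_exists, mem_ofPred_eq, not_and, not_le] at hc
  have hrow := IsZeroTrace.forall_ge_mem (hc.1 hxy).le hxy fun z _ hz => by
    by_contra hcz
    exact hc.2 (z, y) ⟨hz, hcz⟩ hxy rfl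
  obtain ⟨N, hN⟩ := hA.row_bddAbove y
  exact hN (max x N) (by omega) (hrow _ (by omega))

section Topology

variable [TopologicalSpace CZ0]

theorem isOpen_singleton_some [T2Space CZ0] [LocallyCompactSpace CZ0]
    (hmul : Continuous fun st : CZ0 × CZ0 => CZ0mul st.1 st.2) (p : CZ) :
    IsOpen ({some p} : Set CZ0) := by
  have hopen : IsOpen ({none}ᶜ : Set CZ0) := isOpen_compl_singleton
  have : BaireSpace ({none}ᶜ : Set CZ0) := hopen.baireSpace
  have : Nonempty ({none}ᶜ : Set CZ0) := ⟨⟨some p, by simp⟩⟩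
  obtain ⟨⟨q, hq⟩, hint⟩ := nonempty_interior_of_iUnion_of_closed
    (f := fun q : ({none}ᶜ : Set CZ0) => {q}) (fun _ => isClosed_singleton) (iUnion_of_singleton _)
  obtain ⟨⟨c, d⟩, rfl⟩ := Option.ne_none_iff_exists'.1 hq
  have hsub : IsOpen ({⟨some (c, d), hq⟩} : Set ({none}ᶜ : Set CZ0)) := by
    rw [← (subset_singleton_iff_eq.1 interior_subset).resolve_left hint.ne_empty]
    exact isOpen_interior
  have hcd : IsOpen ({some (c, d)} : Set CZ0) := by
    simpa using hopen.isOpenMap_subtype_val _ hsub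
  have hleft : ∀ s, Continuous (CZ0mul s) := fun s => hmul.comp (.prodMk_right s)
  have hright : ∀ s, Continuous fun u => CZ0mul u s := fun s => hmul.comp (.prodMk_left s)
  convert hcd.preimage ((hright (some (p.2 - 1, d - 1))).comp
    (hleft (some (c - 1, p.1 - 1)))) using 1
  ext (_ | q)
  · simp [CZ0mul]
  · simp [CZ0mul, CZmul_CZmul_eq_iff]

theorem isZeroTrace_of_not_isOpen [T2Space CZ0]
    (hmul : Continuous fun st : CZ0 × CZ0 => CZ0mul st.1 st.2)
    (hsome : ∀ p : CZ, IsOpen ({some p} : Set CZ0)) (hnone : ¬ IsOpen ({none} : Set CZ0))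
    {K : Set CZ0} (hK : IsCompact K) (hK0 : K ∈ 𝓝 none) : IsZeroTrace (some ⁻¹' K) := by
  have hfin : ∀ U ∈ 𝓝 (none : CZ0), {a : CZ | some a ∈ K ∧ some a ∉ U}.Finite := by
    intro U hU
    have hcpt : IsCompact (K \ interior U) := hK.diff isOpen_interior
    obtain ⟨s, -, hs⟩ := hcpt.elim_nhds_subcover (fun x => {x}) fun x hx => by
      cases x with
      | none => exact absurd (mem_interior_iff_mem_nhds.2 hU) hx.2
      | some p => exact (hsome p).mem_nhds rfl
    refine (s.finite_toSet.preimage (Option.some_injective _).injOn).subset fun a ha => ?_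
    simpa using hs ⟨ha.1, fun h => ha.2 (interior_subset h)⟩
  have hleft : ∀ p, Tendsto (CZ0mul (some p)) (𝓝 none) (𝓝 none) := fun p =>
    (hmul.comp (.prodMk_right (some p))).tendsto none
  have hright : ∀ p, Tendsto (fun u => CZ0mul u (some p)) (𝓝 none) (𝓝 none) := fun p =>
    (hmul.comp (.prodMk_left (some p))).tendsto none
  have hne : ∀ q : CZ, ({some q}ᶜ : Set CZ0) ∈ 𝓝 none := fun q =>
    isOpen_compl_singleton.mem_nhds (by simp)
  refine ⟨fun hA => hnone ?_, fun p => hfin _ (hleft p hK0), fun p => hfin _ (hright p hK0),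
    fun p q => ?_, fun p q => ?_, fun p => ?_⟩
  · have hC : IsClosed (some '' (some ⁻¹' K : Set CZ)) := (hA.image some).isClosed
    refine isOpen_iff_mem_nhds.2 fun x hx => ?_
    obtain rfl : x = none := hx
    filter_upwards [hK0, hC.isOpen_compl.mem_nhds (by simp)] with u hu hu'
    cases u with
    | none => rfl
    | some a => exact absurd ⟨a, hu, rfl⟩ hu'
  · refine (hfin _ (hleft p (hne q))).subset fun a ha => ⟨ha.1, ?_⟩
    simp [CZ0mul, ha.2]
  · refine (hfin _ (hright p (hne q))).subset fun a ha => ⟨ha.1, ?_⟩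
    simp [CZ0mul, ha.2]
  · have h0 : Tendsto (fun st : CZ0 × CZ0 => CZ0mul st.1 st.2) (𝓝 none ×ˢ 𝓝 none) (𝓝 none) := by
      rw [← nhds_prod_eq]
      exact hmul.tendsto (none, none)
    obtain ⟨V, hV, hVV⟩ := mem_prod_same_iff.1 (h0 (hne p))
    refine ⟨_, hfin V hV, fun a ha b hb ha' hb' hab => ?_⟩
    have haV : some a ∈ V := by by_contra h; exact ha' ⟨ha, h⟩
    have hbV : some b ∈ V := by by_contra h; exact hb' ⟨hb, h⟩
    have := hVV (mk_mem_prod haV hbV)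
    simp [CZ0mul, hab] at this

end Topology

theorem stmt16 (t : TopologicalSpace CZ0) (h2 : @T2Space CZ0 t)
    (hlc : @LocallyCompactSpace CZ0 t)
    (hmul : @Continuous (CZ0 × CZ0) CZ0 (@instTopologicalSpaceProd CZ0 CZ0 t t) t
      (fun st => CZ0mul st.1 st.2)) :
    t = ⊥ := by
  have hsome := isOpen_singleton_some hmul
  refine eq_bot_of_singletons_open fun x => ?_
  cases x with
  | some p => exact hsome p
  | none =>
    by_contra hnone
    obtain ⟨K, hK, hK0⟩ := exists_compact_mem_nhds (none : CZ0)
    exact not_isZeroTrace _ (isZeroTrace_of_not_isOpen hmul hsome hnone hK hK0)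
end
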